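/- For every integer m ≥ 2 and every Δ with Δ = 2^m − 1 or Δ = 2^m, there exist a simple graph G with maximum degree Δ and chromatic index Δ and a proper edge-coloring of G into color classes E_1, …, E_n such that |E_i| ≥ Δ + 2 for every i and G has no full rainbow matching with respect to E_1, …, E_n. -/

import Mathlib

open Finset

/-- The degree of a vertex `v` in the multi-hypergraph with edge family `E`
(edges indexed by `ι`, parallel edges counted as distinct). -/
def mhDeg {V ι : Type} [Fintype ι] [DecidableEq V] (E : ι → Finset V) (v : V) : ℕ :=
  (Finset.univ.filter fun a => v ∈ E a).card

/-- The size of the color class of color `i` under the edge-coloring `c`. -/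
def classSize {ι κ : Type} [Fintype ι] [DecidableEq κ] (c : ι → κ) (i : κ) : ℕ :=
  (Finset.univ.filter fun a => c a = i).card

/-- An edge-coloring is proper if each color class is a matching. -/
def properColoring {V ι κ : Type} (E : ι → Finset V) (c : ι → κ) : Prop :=
  ∀ a b : ι, a ≠ b → c a = c b → Disjoint (E a) (E b)

/-- A full rainbow matching with respect to the coloring `c`: a set of pairwise disjoint
edges containing exactly one edge from each color class. -/
def hasFullRainbowMatching {V ι κ : Type} (E : ι → Finset V) (c : ι → κ) : Prop :=
  ∃ f : κ → ι, (∀ i, c (f i) = i) ∧ ∀ i j : κ, i ≠ j → Disjoint (E (f i)) (E (f j))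

/-- The chromatic index of the edge family `E`: the least number of matchings into which
the edge family can be partitioned. -/
def isChromaticIndex {V ι : Type} (E : ι → Finset V) (χ : ℕ) : Prop :=
  IsLeast {k : ℕ | ∃ c : ι → Fin k, properColoring E c} χ

theorem mhDeg_le_card_of_properColoring {V ι P : Type} [Fintype ι] [DecidableEq V] [Fintype P]
    {E : ι → Finset V} {p : ι → P} (hp : properColoring E p) (v : V) :
    mhDeg E v ≤ Fintype.card P := by
  rw [mhDeg, ← Finset.card_univ]
  refine Finset.card_le_card_of_injOn p (by simp) fun a ha b hb hab => ?_
  simp only [coe_filter, mem_univ, true_and, Set.mem_ofPred_eq] at ha hb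
  by_contra h
  exact Finset.disjoint_left.1 (hp a b h hab) ha hb

/-- Transfer of an example on arbitrary finite types to the types `Fin _`. -/
theorem exists_fin_of_fintype {V ι κ P : Type} [Fintype V] [Fintype ι] [Fintype κ] [Fintype P]
    [DecidableEq V] [DecidableEq κ] {Δ : ℕ} {E : ι → Finset V} {c : ι → κ} {p : ι → P}
    (hcard : ∀ a, (E a).card = 2) (hinj : Function.Injective E)
    (hp : properColoring E p) (hP : Fintype.card P = Δ) (hv : ∃ v, Δ ≤ mhDeg E v)
    (hc : properColoring E c) (hsize : ∀ i, Δ + 2 ≤ classSize c i)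
    (hno : ¬ hasFullRainbowMatching E c) :
    ∃ (N M n : ℕ) (E : Fin M → Finset (Fin N)) (c : Fin M → Fin n),
      (∀ a, (E a).card = 2) ∧
      (∀ a b, a ≠ b → E a ≠ E b) ∧
      (∀ v, mhDeg E v ≤ Δ) ∧ (∃ v, mhDeg E v = Δ) ∧
      isChromaticIndex E Δ ∧
      properColoring E c ∧
      (∀ i : Fin n, Δ + 2 ≤ classSize c i) ∧
      ¬ hasFullRainbowMatching E c := by
  let eV := Fintype.equivFin V
  let eι := Fintype.equivFin ι
  let eκ := Fintype.equivFin κ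
  let eP := Fintype.equivFinOfCardEq hP
  let E' : Fin (Fintype.card ι) → Finset (Fin (Fintype.card V)) :=
    fun a => (E (eι.symm a)).map eV.toEmbedding
  have hp' : properColoring E' fun a => eP (p (eι.symm a)) := fun a b hab h =>
    (Finset.disjoint_map _).2 (hp _ _ (eι.symm.injective.ne hab) (eP.injective h))
  have hle (v) : mhDeg E' v ≤ Δ := by
    simpa using mhDeg_le_card_of_properColoring hp' v
  obtain ⟨v, hv⟩ := hv
  have hge : Δ ≤ mhDeg E' (eV v) := by
    refine hv.trans (Finset.card_le_card_of_injOn eι ?_ eι.injective.injOn)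
    intro a ha
    simpa [E'] using ha
  refine ⟨_, _, Fintype.card κ, E', fun a => eκ (c (eι.symm a)), fun a => ?_, fun a b hab h => ?_,
    hle, ⟨_, (hle _).antisymm hge⟩, ⟨⟨_, hp'⟩, ?_⟩, fun a b hab h => ?_, fun i => ?_, ?_⟩
  · simp [E', hcard]
  · exact hab (eι.symm.injective (hinj (Finset.map_injective _ h)))
  · rintro k ⟨d, hd⟩
    simpa using hge.trans (mhDeg_le_card_of_properColoring hd (eV v))
  · exact (Finset.disjoint_map _).2 (hc _ _ (eι.symm.injective.ne hab) (eκ.injective h))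
  · refine (hsize (eκ.symm i)).trans (Finset.card_le_card_of_injOn eι ?_ eι.injective.injOn)
    intro a ha
    simpa [Equiv.eq_symm_apply] using ha
  · rintro ⟨f, hf, hdisj⟩
    refine hno ⟨fun i => eι.symm (f (eκ i)), fun i => eκ.injective (hf _), fun i j hij => ?_⟩
    exact (Finset.disjoint_map _).1 (hdisj _ _ (eκ.injective.ne hij))

section CharTwo

variable {W : Type} [Field W] [CharP W 2] [DecidableEq W]

theorem sum_pair_ne_zero {s : Finset W} (hs : s.card = 2) : ∑ x ∈ s, x ≠ 0 := by
  obtain ⟨a, b, hab, rfl⟩ := Finset.card_eq_two.1 hs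
  rw [Finset.sum_pair hab]
  exact fun h => hab (CharTwo.add_eq_zero.1 h)

theorem disjoint_of_sum_eq {s t : Finset W} (hs : s.card = 2) (ht : t.card = 2) (hst : s ≠ t)
    (h : ∑ x ∈ s, x = ∑ x ∈ t, x) : Disjoint s t := by
  refine Finset.disjoint_left.2 fun a has hat => hst ?_
  have key {u : Finset W} (hu : u.card = 2) (ha : a ∈ u) : u = {a, a + ∑ x ∈ u, x} := by
    obtain ⟨b, hb⟩ := Finset.card_eq_one.1
      (show (u.erase a).card = 1 by rw [Finset.card_erase_of_mem ha, hu])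
    rw [← Finset.add_sum_erase u _ ha, hb, Finset.sum_singleton, CharTwo.add_cancel_left,
      ← hb, Finset.insert_erase ha]
  rw [key hs has, key ht hat, h]

variable [Fintype W]

theorem card_le_two_mul_card_pairs {d : W} (hd : d ≠ 0) :
    Fintype.card W ≤
      2 * (univ.filter fun s : {s : Finset W // s.card = 2} => ∑ x ∈ s.1, x = d).card := by
  have hne (w : W) : w ≠ w + d := by simpa using hd
  have hsub : (univ : Finset W) ⊆ (univ.filter fun s : {s : Finset W // s.card = 2} =>
      ∑ x ∈ s.1, x = d).biUnion fun s => s.1 := fun w _ => by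
    refine Finset.mem_biUnion.2 ⟨⟨{w, w + d}, Finset.card_pair (hne w)⟩, ?_, by simp⟩
    simp [Finset.sum_pair (hne w), CharTwo.add_cancel_left]
  rw [mul_comm]
  exact (Finset.card_le_card hsub).trans
    (Finset.card_biUnion_le_card_mul _ _ _ fun s _ => s.2.le)

/-- Two disjoint copies of the complete graph on `W`, each coloured by sums, have no full
rainbow matching. -/
theorem not_rainbow_two_copies (hW : 2 < Fintype.card W) (b : {w : W // w ≠ 0} → Bool)
    (s : {w : W // w ≠ 0} → Finset W) (hs : ∀ d, (s d).card = 2)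
    (hsum : ∀ d, ∑ x ∈ s d, x = d)
    (hdisj : ∀ d e, d ≠ e → b d = b e → Disjoint (s d) (s e)) : False := by
  have hzero : ∑ w : W, w = 0 := by
    simpa using FiniteField.sum_pow_lt_card_sub_one W 1 (by omega)
  have hzero' : ∑ d : {w : W // w ≠ 0}, (d : W) = 0 := by
    rw [← Fintype.sum_subtype_add_sum_subtype (fun w : W => w ≠ 0) (fun w => w),
      Finset.sum_eq_zero fun (x : {w : W // ¬ w ≠ 0}) _ => not_not.1 x.2, add_zero] at hzero
    exact hzero
  have heven : Even (Fintype.card W) := by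
    obtain ⟨n, _, hn⟩ := FiniteField.card W 2
    rw [hn]
    exact (even_two).pow_of_ne_zero n.ne_zero
  let T : Finset (Bool × W) := univ.biUnion fun d => {b d} ×ˢ s d
  have hT {A : Type} [AddCommMonoid A] (f : Bool × W → A) :
      ∑ x ∈ T, f x = ∑ d, ∑ w ∈ s d, f (b d, w) := by
    rw [Finset.sum_biUnion]
    · simp
    · intro d _ e _ hde
      refine Finset.disjoint_product.2 ?_
      by_cases hb : b d = b e
      · exact .inr (hdisj d e hde hb)
      · exact .inl (by simpa using hb)
  have hcard : Tᶜ.card = 2 := by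
    have h1 : T.card = (Fintype.card W - 1) * 2 := by
      rw [Finset.card_eq_sum_ones, hT]
      simp [hs, Fintype.card_subtype_compl]
    rw [Finset.card_compl, h1, Fintype.card_prod, Fintype.card_bool]
    omega
  obtain ⟨p, r, hpr, hc⟩ := Finset.card_eq_two.1 hcard
  have hsnd : p.2 + r.2 = 0 := by
    have h1 := Finset.sum_add_sum_compl T fun x => x.2
    rw [hT, hc, Finset.sum_pair hpr, Fintype.sum_prod_type] at h1
    simpa [hsum, hzero, hzero'] using h1
  have hfst : r.1 ≠ p.1 := fun h => hpr (Prod.ext h.symm (CharTwo.add_eq_zero.1 hsnd))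
  have h1 := Finset.sum_add_sum_compl T fun x => if x.1 = p.1 then 1 else 0
  rw [hT, hc, Finset.sum_pair hpr, Fintype.sum_prod_type, if_pos rfl, if_neg hfst] at h1
  have h2 : Even (∑ d, ∑ w ∈ s d, if b d = p.1 then 1 else 0) :=
    Finset.even_sum _ fun d _ => by split_ifs <;> simp [hs]
  have h3 : ∑ x : Bool, ∑ y : W, (if x = p.1 then 1 else 0) = Fintype.card W := by
    simp
  rw [h3] at h1
  have h4 := h1 ▸ heven
  simp only [add_zero, Nat.even_add_one] at h4
  exact h4 h2

end CharTwo

section Construction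

variable {J W L : Type}

/-- The edges of the graph formed, for each `j : J`, by two complete graphs on `W`
and a double star with central edge `none` and leaves `L` on either side. -/
def starEnds [DecidableEq J] [DecidableEq W] [DecidableEq L] :
    J × ((Bool × {s : Finset W // s.card = 2}) ⊕ Option (Bool × L)) →
      Finset (J × ((Bool × W) ⊕ (Bool ⊕ Bool × L)))
  | (j, .inl (b, s)) => s.1.image fun w => (j, .inl (b, w))
  | (j, .inr none) => {(j, .inr (.inl false)), (j, .inr (.inl true))}
  | (j, .inr (some (b, l))) => {(j, .inr (.inl b)), (j, .inr (.inr (b, l)))}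

variable [Field W] [CharP W 2] [DecidableEq W]

/-- The colouring without a full rainbow matching: the central edges of the double stars form one
class, the other edges at `j` are coloured by `j` and a nonzero element of `W`. -/
def starColor (α : Bool → L → {w : W // w ≠ 0}) :
    J × ((Bool × {s : Finset W // s.card = 2}) ⊕ Option (Bool × L)) →
      Option (J × {w : W // w ≠ 0})
  | (j, .inl (_, s)) => some (j, ⟨∑ x ∈ s.1, x, sum_pair_ne_zero s.2⟩)
  | (_, .inr none) => none
  | (j, .inr (some (b, l))) => some (j, α b l)

/-- An optimal proper colouring of the same graph. -/
def starOptimalColor (γ : {w : W // w ≠ 0} → Option L) :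
    J × ((Bool × {s : Finset W // s.card = 2}) ⊕ Option (Bool × L)) → Option L
  | (_, .inl (_, s)) => γ ⟨∑ x ∈ s.1, x, sum_pair_ne_zero s.2⟩
  | (_, .inr none) => none
  | (_, .inr (some (_, l))) => some l

variable [DecidableEq J] [DecidableEq L]

omit [Field W] [CharP W 2] in
theorem card_starEnds (a : J × ((Bool × {s : Finset W // s.card = 2}) ⊕ Option (Bool × L))) :
    (starEnds a).card = 2 := by
  obtain ⟨j, ⟨b, s⟩ | _ | ⟨b, l⟩⟩ := a
  · rw [starEnds, Finset.card_image_of_injective _ (fun x y h => by simpa using h), s.2]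
  · simp [starEnds]
  · simp [starEnds]

theorem properColoring_starColor {α : Bool → L → {w : W // w ≠ 0}}
    (hα : ∀ b, Function.Injective (α b)) :
    properColoring (starEnds (J := J)) (starColor α) := by
  rintro ⟨j, ⟨b, s⟩ | _ | ⟨b, l⟩⟩ ⟨j', ⟨b', s'⟩ | _ | ⟨b', l'⟩⟩ hne h <;>
    simp [starColor] at h
  · obtain ⟨rfl, h⟩ := h
    by_cases hb : b = b'
    · subst hb
      have hs : s.1 ≠ s'.1 := fun hs => hne (by rw [Subtype.ext hs])
      exact (Finset.disjoint_image fun x y h => by simpa using h).2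
        (disjoint_of_sum_eq s.2 s'.2 hs h)
    · simp only [starEnds, Finset.disjoint_left, Finset.mem_image]
      rintro _ ⟨x, _, rfl⟩ ⟨y, _, h⟩
      simp [Ne.symm hb] at h
  · simp [starEnds, Finset.disjoint_left]
  · have : j ≠ j' := by rintro rfl; exact hne rfl
    simp [starEnds, this.symm]
  · simp [starEnds, Finset.disjoint_left]
  · obtain ⟨rfl, h⟩ := h
    have hb : b ≠ b' := by
      rintro rfl
      exact hne (by rw [hα b h])
    simp [starEnds, hb.symm]

theorem properColoring_starOptimalColor {γ : {w : W // w ≠ 0} → Option L}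
    (hγ : Function.Injective γ) :
    properColoring (starEnds (J := J)) (starOptimalColor γ) := by
  rintro ⟨j, ⟨b, s⟩ | _ | ⟨b, l⟩⟩ ⟨j', ⟨b', s'⟩ | _ | ⟨b', l'⟩⟩ hne h <;>
    simp only [starOptimalColor, reduceCtorEq, Option.some.injEq] at h
  · by_cases hb : j = j' ∧ b = b'
    · obtain ⟨rfl, rfl⟩ := hb
      have hs : s.1 ≠ s'.1 := fun hs => hne (by rw [Subtype.ext hs])
      exact (Finset.disjoint_image fun x y h => by simpa using h).2
        (disjoint_of_sum_eq s.2 s'.2 hs (congrArg Subtype.val (hγ h)))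
    · simp only [starEnds, Finset.disjoint_left, Finset.mem_image]
      rintro _ ⟨x, _, rfl⟩ ⟨y, _, h⟩
      simp at h
      exact hb ⟨h.1.symm, h.2.1.symm⟩
  · simp [starEnds, Finset.disjoint_left]
  · simp [starEnds, Finset.disjoint_left]
  · simp [starEnds, Finset.disjoint_left]
  · have : j ≠ j' := by rintro rfl; exact hne rfl
    simp [starEnds, this.symm]
  · simp [starEnds, Finset.disjoint_left]
  · subst h
    have hb : j = j' → b ≠ b' := by
      rintro rfl rfl
      exact hne rfl
    simp [starEnds]
    grind

omit [Field W] [CharP W 2] in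
theorem injective_starEnds : Function.Injective (starEnds (J := J) (W := W) (L := L)) := by
  rintro ⟨j, ⟨b, s⟩ | _ | ⟨b, l⟩⟩ ⟨j', ⟨b', s'⟩ | _ | ⟨b', l'⟩⟩ h
  · obtain ⟨w, hw⟩ := Finset.card_pos.1 (s.2.symm ▸ two_pos)
    have hj : j = j' ∧ b = b' := by
      have : (j, .inl (b, w)) ∈ starEnds (L := L) (j', .inl (b', s')) := by
        rw [← h]; exact Finset.mem_image_of_mem _ hw
      obtain ⟨x, -, hx⟩ := Finset.mem_image.1 this
      simp only [Prod.mk.injEq, Sum.inl.injEq] at hx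
      exact ⟨hx.1.symm, hx.2.1.symm⟩
    obtain ⟨rfl, rfl⟩ := hj
    rw [Subtype.ext (Finset.image_injective (fun x y h => by simpa using h) h)]
  all_goals
    have h1 := fun x => Finset.ext_iff.1 h x
    simp only [starEnds, Finset.mem_image, Finset.mem_insert, Finset.mem_singleton] at h1
  · simpa using h1 (j', .inr (.inl false))
  · simpa using h1 (j', .inr (.inl b'))
  · simpa using h1 (j, .inr (.inl false))
  · have := h1 (j, .inr (.inl false))
    simp at this
    rw [this]
  · simpa using h1 (j', .inr (.inr (b', l')))
  · simpa using h1 (j, .inr (.inl b))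
  · simpa using h1 (j, .inr (.inr (b, l)))
  · have := h1 (j, .inr (.inr (b, l)))
    simp at this
    obtain ⟨rfl, rfl, rfl⟩ := this
    rfl

theorem not_hasFullRainbowMatching_starColor [Fintype W] (hW : 2 < Fintype.card W)
    (α : Bool → L → {w : W // w ≠ 0}) :
    ¬ hasFullRainbowMatching (starEnds (J := J)) (starColor α) := by
  rintro ⟨f, hf, hdisj⟩
  obtain ⟨j, hj⟩ : ∃ j, f none = (j, .inr none) := by
    have := hf none
    generalize f none = a at this ⊢
    obtain ⟨j, ⟨b, s⟩ | _ | ⟨b, l⟩⟩ := a <;> simp [starColor] at this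
    exact ⟨j, rfl⟩
  have hpair (d : {w : W // w ≠ 0}) : ∃ (b : Bool) (s : {s : Finset W // s.card = 2}),
      f (some (j, d)) = (j, .inl (b, s)) ∧ ∑ x ∈ s.1, x = d := by
    have h1 := hf (some (j, d))
    have h2 := hdisj none (some (j, d)) (by simp)
    rw [hj] at h2
    generalize f (some (j, d)) = a at h1 h2 ⊢
    obtain ⟨j', ⟨b, s⟩ | _ | ⟨b, l⟩⟩ := a <;> simp [starColor] at h1
    · obtain ⟨rfl, rfl⟩ := h1
      exact ⟨b, s, rfl, rfl⟩
    · obtain ⟨rfl, -⟩ := h1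
      cases b <;> simp [starEnds] at h2
  choose b s hfs hsum using hpair
  refine not_rainbow_two_copies hW b (fun d => s d) (fun d => (s d).2) hsum fun d e hde hb => ?_
  have h := hdisj (some (j, d)) (some (j, e)) (by simpa using hde)
  rw [hfs, hfs, hb] at h
  exact (Finset.disjoint_image fun x y h => by simpa using h).1 h

omit [Field W] [CharP W 2] in
theorem le_mhDeg_starEnds [Fintype J] [Fintype W] [Fintype L] (j : J) :
    Fintype.card L + 1 ≤ mhDeg (starEnds (W := W) (L := L)) (j, .inr (.inl false)) := by
  rw [← Fintype.card_option, ← Finset.card_univ, mhDeg]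
  refine Finset.card_le_card_of_injOn
    (fun o => (j, .inr (o.map fun l => (false, l)))) ?_ ?_
  · rintro (_ | l) - <;>
      simp only [Finset.coe_filter, mem_univ, true_and, Set.mem_ofPred_eq] <;> simp [starEnds]
  · rintro (_ | l) - (_ | l') - <;> simp

omit [DecidableEq L] in
theorem card_le_classSize_starColor_none [Fintype J] [Fintype W] [Fintype L]
    (α : Bool → L → {w : W // w ≠ 0}) :
    Fintype.card J ≤ classSize (starColor (J := J) α) none := by
  rw [← Finset.card_univ, classSize]
  refine Finset.card_le_card_of_injOn (fun j => (j, .inr none)) ?_ ?_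
  · exact fun j _ => Finset.mem_coe.2 (Finset.mem_filter.2 ⟨mem_univ _, by simp [starColor]⟩)
  · intro j _ j' _
    simp

omit [DecidableEq L] in
theorem card_add_le_classSize_starColor_some [Fintype J] [Fintype W] [Fintype L]
    (α : Bool → L → {w : W // w ≠ 0}) (j : J) (d : {w : W // w ≠ 0}) :
    Fintype.card W + (univ.filter fun x : Bool × L => α x.1 x.2 = d).card ≤
      classSize (starColor α) (some (j, d)) := by
  refine (Nat.add_le_add_right (card_le_two_mul_card_pairs d.2) _).trans ?_
  rw [← congrArg (· * _) Fintype.card_bool, ← Finset.card_univ, ← Finset.card_product,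
    ← Finset.card_disjSum, classSize]
  refine Finset.card_le_card_of_injOn (fun x => (j, x.map id some)) ?_ ?_
  · rintro (⟨b, s⟩ | ⟨b, l⟩) h <;>
      rw [Finset.mem_coe, Finset.mem_filter] <;> simpa [starColor, Subtype.ext_iff] using h
  · rintro (x | x) - (y | y) - <;> simp

end Construction

theorem exists_of_leaf_colors {W L : Type} [Field W] [CharP W 2] [Fintype W] [Fintype L]
    [DecidableEq W] (hW : 2 < Fintype.card W) {Δ : ℕ} (hL : Fintype.card L + 1 = Δ)
    (hWΔ : Fintype.card W ≤ Δ + 1)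
    (α : Bool → L → {w : W // w ≠ 0}) (hα : ∀ b, Function.Injective (α b))
    (hsize : ∀ d, Δ + 2 ≤ Fintype.card W + (univ.filter fun x : Bool × L => α x.1 x.2 = d).card) :
    ∃ (N M n : ℕ) (E : Fin M → Finset (Fin N)) (c : Fin M → Fin n),
      (∀ a, (E a).card = 2) ∧
      (∀ a b, a ≠ b → E a ≠ E b) ∧
      (∀ v, mhDeg E v ≤ Δ) ∧ (∃ v, mhDeg E v = Δ) ∧
      isChromaticIndex E Δ ∧
      properColoring E c ∧
      (∀ i : Fin n, Δ + 2 ≤ classSize c i) ∧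
      ¬ hasFullRainbowMatching E c := by
  classical
  obtain ⟨γ⟩ : Nonempty ({w : W // w ≠ 0} ↪ Option L) := by
    refine Function.Embedding.nonempty_of_card_le ?_
    simp [Fintype.card_subtype_compl]
    omega
  refine exists_fin_of_fintype (E := starEnds (J := Fin (Δ + 2)) (W := W) (L := L)) card_starEnds
    injective_starEnds (properColoring_starOptimalColor γ.injective) (by simpa using hL)
    ⟨(0, .inr (.inl false)), hL ▸ le_mhDeg_starEnds _⟩ (properColoring_starColor hα) ?_
    (not_hasFullRainbowMatching_starColor hW α)
  rintro (_ | ⟨j, d⟩)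
  · simpa using card_le_classSize_starColor_none (J := Fin (Δ + 2)) α
  · exact (hsize d).trans (card_add_le_classSize_starColor_some α j d)

/-- For every `m ≥ 2` and `Δ ∈ {2^m - 1, 2^m}` there is a properly edge-colored simple graph
with maximum degree `Δ` and chromatic index `Δ`, all color classes of size at least `Δ + 2`,
and no full rainbow matching. -/
theorem stmt8 (m Δ : ℕ) (hm : 2 ≤ m) (hΔ : Δ = 2 ^ m - 1 ∨ Δ = 2 ^ m) :
    ∃ (N M n : ℕ) (E : Fin M → Finset (Fin N)) (c : Fin M → Fin n),
      (∀ a, (E a).card = 2) ∧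
      (∀ a b, a ≠ b → E a ≠ E b) ∧
      (∀ v, mhDeg E v ≤ Δ) ∧ (∃ v, mhDeg E v = Δ) ∧
      isChromaticIndex E Δ ∧
      properColoring E c ∧
      (∀ i : Fin n, Δ + 2 ≤ classSize c i) ∧
      ¬ hasFullRainbowMatching E c := by
  classical
  have : Fintype (GaloisField 2 m) := Fintype.ofFinite _
  have hq : Fintype.card (GaloisField 2 m) = 2 ^ m := by
    rw [← Nat.card_eq_fintype_card, GaloisField.card 2 m (by omega)]
  have h4 : 2 ^ 2 ≤ 2 ^ m := Nat.pow_le_pow_right two_pos hm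
  have hD : Fintype.card {w : GaloisField 2 m // w ≠ 0} = 2 ^ m - 1 := by
    simp [Fintype.card_subtype_compl, hq]
  rcases hΔ with rfl | rfl
  · obtain ⟨d₁, d₂, hd⟩ :=
      Fintype.exists_pair_of_one_lt_card (α := {w : GaloisField 2 m // w ≠ 0}) (by omega)
    refine exists_of_leaf_colors (L := {d : {w : GaloisField 2 m // w ≠ 0} // d ≠ d₁})
      (by omega) ?_ (by omega)
      (fun b l => if b then l.1 else Equiv.swap d₁ d₂ l.1) ?_ fun d => ?_
    · rw [Fintype.card_subtype_compl, hD, Fintype.card_subtype_eq]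
      omega
    · rintro (_ | _)
      · exact (Equiv.swap d₁ d₂).injective.comp Subtype.val_injective
      · exact Subtype.val_injective
    · have : 0 < (univ.filter fun x : Bool × {d : {w : GaloisField 2 m // w ≠ 0} // d ≠ d₁} =>
          (if x.1 then x.2.1 else Equiv.swap d₁ d₂ x.2.1) = d).card := by
        refine Finset.card_pos.2 ?_
        by_cases h : d = d₁
        · exact ⟨(false, ⟨d₂, hd.symm⟩), by simp [h]⟩
        · exact ⟨(true, ⟨d, h⟩), by simp⟩
      omega
  · refine exists_of_leaf_colors (L := {w : GaloisField 2 m // w ≠ 0})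
      (by omega) (by omega) (by omega) (fun _ l => l) (fun _ => Function.injective_id) fun d => ?_
    have : 2 ≤ (univ.filter fun x : Bool × {w : GaloisField 2 m // w ≠ 0} => x.2 = d).card := by
      refine Fintype.card_bool.symm.trans_le (Finset.card_univ.symm.trans_le ?_)
      exact Finset.card_le_card_of_injOn (fun b => (b, d)) (by intro b; simp) (by intro b; simp)
    omega
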